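/- Let A and B be unital C*-algebras, ψ : A → B a continuous linear completely positive map, H a group, u : H → A a group homomorphism into the unitary group of A, and p₁, …, pₙ a compatible chain of self-adjoint idempotents in B. Assume that ψ(u h) ∈ D_{p₁} ∪ … ∪ D_{pₙ} for every h ∈ H, and that for each i there exists h ∈ H with ψ(u h) ∈ D_{pᵢ}. Then ψ 1 = p₁, and there exists a compatible system of homomorphisms (H₁ ≤ … ≤ Hₙ, β₁, …, βₙ) for p₁, …, pₙ with Hₙ = H whose fusion map is h ↦ ψ(u h); that is, ψ(u h) = β_k(h) whenever h ∈ H_k \ H_{k−1} (with H₀ = ∅). -/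

import Mathlib

/-- For `p` a self-adjoint idempotent, `Dset p = {x | star x * x = p ∧ x * star x = p}`. -/
def Dset {B : Type*} [Mul B] [Star B] (p : B) : Set B :=
  {x | star x * x = p ∧ x * star x = p}

/-- A continuous linear map `ψ : A → B` between unital C*-algebras is completely positive
if `0 ≤ ∑ᵢ ∑ⱼ star (b i) * ψ (star (a i) * a j) * (b j)` for all finite tuples. -/
def CompletelyPositive {A B : Type*}
    [NormedRing A] [StarRing A] [NormedAlgebra ℂ A]
    [NormedRing B] [StarRing B] [NormedAlgebra ℂ B] [PartialOrder B]
    (ψ : A →L[ℂ] B) : Prop :=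
  ∀ (n : ℕ) (a : Fin n → A) (b : Fin n → B),
    0 ≤ ∑ i : Fin n, ∑ j : Fin n, star (b i) * ψ (star (a i) * a j) * b j

section CStar

variable {B : Type*} [NormedRing B] [StarRing B]

theorem star_mem_Dset {p x : B} (hx : x ∈ Dset p) : star x ∈ Dset p :=
  ⟨by rw [star_star]; exact hx.2, by rw [star_star]; exact hx.1⟩

theorem eq_zero_of_neg_star_mul_self_nonneg [CStarRing B] [PartialOrder B] [StarOrderedRing B]
    {d : B} (h : 0 ≤ -(star d * d)) : d = 0 :=
  (CStarRing.star_mul_self_eq_zero_iff d).1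
    (le_antisymm (neg_nonneg.1 h) (star_mul_self_nonneg d))

theorem mul_eq_self_of_mem_Dset [CStarRing B] {p x : B} (hp : star p = p) (hpp : p * p = p)
    (hx : x ∈ Dset p) : x * p = x := by
  have h : star (x - x * p) * (x - x * p) = 0 := by
    have e : star (x - x * p) * (x - x * p)
        = star x * x - star x * x * p - (p * (star x * x) - p * (star x * x) * p) := by
      rw [star_sub, star_mul, hp]; noncomm_ring
    rw [e, hx.1, hpp, hpp]; simp
  exact (sub_eq_zero.1 ((CStarRing.star_mul_self_eq_zero_iff _).1 h)).symm

theorem mul_eq_self_of_mem_Dset' [CStarRing B] {p x : B} (hp : star p = p) (hpp : p * p = p)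
    (hx : x ∈ Dset p) : p * x = x := by
  have h := congrArg star (mul_eq_self_of_mem_Dset hp hpp (star_mem_Dset hx))
  rwa [star_mul, star_star, hp] at h

theorem mul_mem_Dset [CStarRing B] {p x y : B} (hp : star p = p) (hpp : p * p = p)
    (hx : x ∈ Dset p) (hy : y ∈ Dset p) : x * y ∈ Dset p := by
  constructor
  · rw [star_mul, mul_assoc, ← mul_assoc (star x), hx.1, mul_eq_self_of_mem_Dset' hp hpp hy, hy.1]
  · rw [star_mul, mul_assoc, ← mul_assoc y, hy.2, ← mul_assoc, mul_eq_self_of_mem_Dset hp hpp hx,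
      hx.2]

/-- Cutting an element of `Dset p` by a commuting subprojection `q ≤ p`. -/
theorem subprojection_mul_mem_Dset {p q x : B} (hq : star q = q) (hqq : q * q = q)
    (hqp : q * p = q) (hx : x ∈ Dset p) (hc : q * x = x * q) : q * x ∈ Dset q := by
  have hc' : star x * q = q * star x := by
    have := congrArg star hc
    rwa [star_mul, star_mul, hq] at this
  constructor
  · rw [star_mul, hq, mul_assoc, ← mul_assoc q, hqq, ← mul_assoc, hc', mul_assoc, hx.1, hqp]
  · rw [star_mul, hq, mul_assoc, hc', ← mul_assoc x, ← hc, mul_assoc, hx.2, hqp, hqq]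

theorem eq_of_nonneg_of_mem_Dset [CStarRing B] [PartialOrder B] [StarOrderedRing B] {p s : B}
    (hp : star p = p) (hpp : p * p = p) (hs : 0 ≤ s) (hsp : s ∈ Dset p) : s = p := by
  have hss : star s = s := (IsSelfAdjoint.of_nonneg hs).star_eq
  have h1 : s * s = p := by have := hsp.1; rwa [hss] at this
  have h2 := mul_eq_self_of_mem_Dset hp hpp hsp
  have h3 := mul_eq_self_of_mem_Dset' hp hpp hsp
  have hd : star (p - s) = p - s := by rw [star_sub, hp, hss]
  have h4 : (p - s) * s = -(p - s) := by rw [sub_mul, h3, h1]; abel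
  have h := star_left_conjugate_nonneg hs (p - s)
  rw [hd, h4, neg_mul] at h
  refine (sub_eq_zero.1 (eq_zero_of_neg_star_mul_self_nonneg (d := p - s) ?_)).symm
  rwa [hd]

/-- An operator-valued function of positive type on a group. -/
def IsPositiveType {H : Type*} [Group H] [PartialOrder B] (φ : H → B) : Prop :=
  ∀ (n : ℕ) (g : Fin n → H) (b : Fin n → B),
    0 ≤ ∑ i : Fin n, ∑ j : Fin n, star (b i) * φ ((g i)⁻¹ * g j) * b j

namespace IsPositiveType

variable {H : Type*} [Group H] [PartialOrder B] {φ : H → B}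

theorem map_one_nonneg (hφ : IsPositiveType φ) : 0 ≤ φ 1 := by
  simpa using hφ 1 (fun _ => 1) (fun _ => 1)

theorem pair_nonneg (hφ : IsPositiveType φ) (h : H) (b c : B) :
    0 ≤ star b * φ 1 * b + star b * φ h * c + (star c * φ h⁻¹ * b + star c * φ 1 * c) := by
  simpa [Fin.sum_univ_two] using hφ 2 ![1, h] ![b, c]

variable [StarOrderedRing B]

theorem map_inv [NormedAlgebra ℂ B] [StarModule ℂ B] (hφ : IsPositiveType φ) (h : H) :
    φ h⁻¹ = star (φ h) := by
  have h1 := (IsSelfAdjoint.of_nonneg hφ.map_one_nonneg).star_eq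
  have e1 := (IsSelfAdjoint.of_nonneg (hφ.pair_nonneg h 1 1)).star_eq
  have e2 := (IsSelfAdjoint.of_nonneg (hφ.pair_nonneg h 1 (Complex.I • 1))).star_eq
  simp only [star_one, one_mul, mul_one, star_add, h1] at e1
  simp only [star_one, one_mul, mul_one, star_add, star_smul, smul_mul_assoc,
    mul_smul_comm, h1, RCLike.star_def, Complex.conj_I, smul_smul, neg_smul, smul_neg, star_neg,
    neg_neg, neg_mul, Complex.I_mul_I, one_smul] at e2
  have f1 : star (φ h) - φ h⁻¹ = φ h - star (φ h⁻¹) := by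
    linear_combination (norm := abel) e1
  have f2 : Complex.I • (star (φ h⁻¹) - star (φ h)) = Complex.I • (φ h - φ h⁻¹) := by
    rw [smul_sub, smul_sub]
    linear_combination (norm := abel) e2
  have f3 := smul_right_injective B Complex.I_ne_zero f2
  have f4 : (2 : ℂ) • (star (φ h) - φ h⁻¹) = 0 := by
    rw [two_smul]
    linear_combination (norm := abel) f1 - f3
  have f5 := (smul_eq_zero.1 f4).resolve_left two_ne_zero
  exact (sub_eq_zero.1 f5).symm

/-- If a function of positive type takes a projection `q` as its value at `1`, then `q` is not
strictly below any projection `p` for which `Dset p` is hit. -/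
theorem eq_of_mem_Dset [CStarRing B] (hφ : IsPositiveType φ)
    (hinv : ∀ h, φ h⁻¹ = star (φ h)) {p q : B} (hp : star p = p)
    (hpp : p * p = p) (hq : star q = q) (hqq : q * q = q) (hpq : p * q = q) (hqp : q * p = q)
    (h1 : φ 1 = q) {h : H} (hh : φ h ∈ Dset p) : q = p := by
  have hr : star (p - q) = p - q := by rw [star_sub, hp, hq]
  have hrr : (p - q) * (p - q) = p - q := by
    rw [sub_mul, mul_sub, mul_sub, hpp, hpq, hqp, hqq]; abel
  have hrq : (p - q) * q = 0 := by rw [sub_mul, hpq, hqq, sub_self]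
  have hrp : (p - q) * p = p - q := by rw [sub_mul, hpp, hqp]
  set r := p - q with hr_def
  set x := φ h with hx_def
  have hxr : r * (star x * x) * r = r := by rw [hh.1, hrp, hrr]
  have hP := hφ.pair_nonneg h (-(x * r)) r
  have hS := star_mul_self_nonneg ((1 - q) * (x * r))
  have e : star (-(x * r)) * φ 1 * -(x * r) + star (-(x * r)) * φ h * r
      + (star r * φ h⁻¹ * -(x * r) + star r * φ 1 * r) + star ((1 - q) * (x * r)) *
        ((1 - q) * (x * r)) = -(star r * r) := by
    have hq1 : (1 - q) * ((1 - q) * (x * r)) = x * r - q * (x * r) := by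
      rw [← mul_assoc, sub_mul, mul_sub, mul_sub, hqq]; noncomm_ring
    rw [h1, hinv, ← hx_def, star_mul (1 - q), mul_assoc _ (star (1 - q)), star_sub 1 q, hq,
      star_one, hq1]
    simp only [star_neg, star_mul, hr, hrq, hrr]
    have : r * star x * q * (x * r) = r * star x * (q * (x * r)) := by rw [mul_assoc]
    simp only [neg_mul, mul_neg, neg_neg, mul_sub, this]
    have h5 : r * star x * x * r = r := by rw [mul_assoc r, hxr]
    have h6 : r * star x * (x * r) = r := by rw [← mul_assoc, h5]
    rw [h5, h6, zero_mul]
    abel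
  have := add_nonneg hP hS
  rw [e] at this
  exact (sub_eq_zero.1 (eq_zero_of_neg_star_mul_self_nonneg this)).symm

/-- Multiplicative domain argument for the compression of a function of positive type by a
projection. -/
theorem compression_mul [CStarRing B] (hφ : IsPositiveType φ)
    (hinv : ∀ h, φ h⁻¹ = star (φ h)) {q : B} (hq : star q = q) (hqq : q * q = q)
    (h1 : φ 1 * q = q) {h : H} (hc : q * φ h = φ h * q) (hh : q * φ h ∈ Dset q) (g : H) :
    q * φ (g * h) * q = q * φ g * (q * φ h) := by
  obtain ⟨X, hX⟩ : ∃ X, X = q * φ h := ⟨_, rfl⟩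
  have hX' : φ h * q = X := by rw [hX, hc]
  rw [← hX] at hh ⊢
  have hqX : q * X = X := by rw [hX, ← mul_assoc, hqq]
  obtain ⟨D, hD⟩ : ∃ D, D = q * φ (g * h) * q - q * φ g * X := ⟨_, rfl⟩
  have hqD : q * D = D := by
    rw [hD, mul_sub]; simp only [← mul_assoc, hqq]
  have hDq : star D * q = star D := by
    have := congrArg star hqD
    rwa [star_mul, hq] at this
  have hsX : q * star (φ h) = star X := by rw [← hX', star_mul, hq]
  have hφX : φ 1 * X = X := by rw [← hqX, ← mul_assoc, h1]
  have hφD : φ 1 * D = D := by rw [← hqD, ← mul_assoc, h1]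
  have hXX : star X * X = q := hh.1
  have e1 : star D * (φ (g * h) * q) - star D * (φ g * X) = star D * D := by
    conv_lhs => rw [← hDq]
    conv_rhs => rw [← hDq, mul_assoc, hqD, congrArg (star D * ·) hD]
    noncomm_ring
  have e2 : q * (star (φ (g * h)) * D) - star X * (star (φ g) * D) = star D * D := by
    have hDs : star D = q * star (φ (g * h)) * q - star X * star (φ g) * q := by
      rw [hD]; simp only [star_sub, star_mul, hq, mul_assoc]
    conv_lhs => rw [← hqD]
    rw [hDs]
    noncomm_ring
  have hqX' : q * (star (φ h) * X) = q := by rw [← mul_assoc, hsX, hXX]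
  have hs1 : star (φ 1) = φ 1 := by rw [← hinv, inv_one]
  have hP := hφ 3 ![1, h, g⁻¹] ![-X, q, -D]
  simp only [Fin.sum_univ_three, Matrix.cons_val, inv_one, one_mul, mul_one, inv_inv,
    inv_mul_cancel, mul_inv_cancel, ← mul_inv_rev, hinv, star_neg, hq, neg_mul, mul_neg, neg_neg,
    mul_assoc, hs1, star_star, hφX, hφD, h1, hqq, hX', hXX, hqX'] at hP
  refine sub_eq_zero.1 (hD.symm.trans (eq_zero_of_neg_star_mul_self_nonneg (d := D) ?_))
  convert hP using 1
  linear_combination (norm := abel) e1 + e2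

end IsPositiveType

end CStar

/-- If `ψ` is completely positive, `u : H → A` a unitary representation, and every
`ψ (u h)` lies in `D_{p 1} ∪ ⋯ ∪ D_{p n}` for a compatible chain `p 1, …, p n`, each
`D_{p i}` being hit, then `ψ 1 = p 1` and `h ↦ ψ (u h)` is the fusion map of a
compatible system of homomorphisms for `p 1, …, p n` with `Hsub n = H`. -/
theorem stmt15 {A B : Type*}
    [NormedRing A] [StarRing A] [CStarRing A] [CompleteSpace A]
    [NormedAlgebra ℂ A] [StarModule ℂ A]
    [NormedRing B] [StarRing B] [CStarRing B] [CompleteSpace B]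
    [NormedAlgebra ℂ B] [StarModule ℂ B] [PartialOrder B] [StarOrderedRing B]
    {H : Type*} [Group H]
    (ψ : A →L[ℂ] B) (hψ : CompletelyPositive ψ)
    (u : H → A) (hu1 : u 1 = 1) (humul : ∀ g h : H, u (g * h) = u g * u h)
    (huni : ∀ g : H, star (u g) * u g = 1 ∧ u g * star (u g) = 1)
    (n : ℕ) (hn : 1 ≤ n) (p : ℕ → B)
    (hsa : ∀ i, 1 ≤ i → i ≤ n → star (p i) = p i ∧ p i * p i = p i)
    (hchain : ∀ i, 1 ≤ i → i < n →
      p i * p (i + 1) = p (i + 1) ∧ p (i + 1) * p i = p (i + 1))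
    (hcomm : ∀ i, 1 ≤ i → i < n → ∀ x ∈ Dset (p i), p (i + 1) * x = x * p (i + 1))
    (hrange : ∀ h : H, ∃ i, 1 ≤ i ∧ i ≤ n ∧ ψ (u h) ∈ Dset (p i))
    (hsurj : ∀ i, 1 ≤ i → i ≤ n → ∃ h : H, ψ (u h) ∈ Dset (p i)) :
    ψ 1 = p 1 ∧
    ∃ (Hsub : ℕ → Subgroup H) (β : ℕ → H → B),
      Hsub n = ⊤ ∧
      (∀ i, 1 ≤ i → i < n → Hsub i ≤ Hsub (i + 1)) ∧
      (∀ i, 1 ≤ i → i ≤ n → ∀ h ∈ Hsub i, β i h ∈ Dset (p i)) ∧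
      (∀ i, 1 ≤ i → i ≤ n → ∀ h ∈ Hsub i, ∀ k ∈ Hsub i,
        β i (h * k) = β i h * β i k) ∧
      (∀ i, 1 ≤ i → i < n → ∀ h ∈ Hsub i, β (i + 1) h = p (i + 1) * β i h) ∧
      (∀ k, 1 ≤ k → k ≤ n → ∀ h : H, h ∈ Hsub k → (k = 1 ∨ h ∉ Hsub (k - 1)) →
        ψ (u h) = β k h) := by
  have hus (g : H) : u g⁻¹ = star (u g) := by
    rw [← mul_one (u g⁻¹), ← (huni g).2, ← mul_assoc, ← humul, inv_mul_cancel, hu1, one_mul]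
  obtain ⟨φ, hφψ⟩ : ∃ φ : H → B, ∀ h, φ h = ψ (u h) := ⟨_, fun _ => rfl⟩
  have hφ : IsPositiveType φ := fun m g b => by
    simpa only [hφψ, humul, hus] using hψ m (fun i => u (g i)) b
  have hinv := hφ.map_inv
  simp only [← hφψ] at hrange hsurj ⊢
  rw [← hu1, ← hφψ]
  have hle : ∀ i k, 1 ≤ i → i ≤ k → k ≤ n → p i * p k = p k ∧ p k * p i = p k := by
    intro i k hi hik
    induction k, hik using Nat.le_induction with
    | base => exact fun hk => ⟨(hsa i hi hk).2, (hsa i hi hk).2⟩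
    | succ k hik ih =>
      intro hk
      obtain ⟨h1, h2⟩ := ih (by omega)
      obtain ⟨h3, h4⟩ := hchain k (by omega) hk
      exact ⟨by rw [← h3, ← mul_assoc, h1], by rw [← h4, mul_assoc, h2]⟩
  have hcomm_le : ∀ i k, 1 ≤ i → i ≤ k → k ≤ n → ∀ x ∈ Dset (p i), p k * x = x * p k := by
    intro i k hi hik
    induction k, hik using Nat.le_induction with
    | base =>
      intro hk x hx
      obtain ⟨h1, h2⟩ := hsa i hi hk
      rw [mul_eq_self_of_mem_Dset h1 h2 hx, mul_eq_self_of_mem_Dset' h1 h2 hx]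
    | succ k hik ih =>
      intro hk x hx
      have hc := ih (by omega) x hx
      obtain ⟨h1, h2⟩ := hsa k (by omega) (by omega)
      obtain ⟨h3, h4⟩ := hchain k (by omega) hk
      have := hcomm k (by omega) hk _
        (subprojection_mul_mem_Dset h1 h2 (hle i k hi hik (by omega)).2 hx hc)
      rwa [← mul_assoc, h4, hc, mul_assoc, h3] at this
  have hcut : ∀ i k, 1 ≤ i → i ≤ k → k ≤ n → ∀ x ∈ Dset (p i), p k * x ∈ Dset (p k) := by
    intro i k hi hik hk x hx
    obtain ⟨h1, h2⟩ := hsa k (by omega) hk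
    exact subprojection_mul_mem_Dset h1 h2 (hle i k hi hik hk).2 hx (hcomm_le i k hi hik hk x hx)
  have hone : φ 1 = p 1 := by
    obtain ⟨j, hj1, hjn, hj⟩ := hrange 1
    obtain ⟨h1, h2⟩ := hsa j hj1 hjn
    obtain ⟨h3, h4⟩ := hsa 1 le_rfl hn
    have hφj := eq_of_nonneg_of_mem_Dset h1 h2 hφ.map_one_nonneg hj
    obtain ⟨h, hh⟩ := hsurj 1 le_rfl hn
    obtain ⟨h5, h6⟩ := hle 1 j le_rfl hj1 hjn
    rw [hφj]
    exact hφ.eq_of_mem_Dset hinv h3 h4 h1 h2 h5 h6 hφj hh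
  have hmul : ∀ k, 1 ≤ k → k ≤ n → ∀ g h, (∃ i, 1 ≤ i ∧ i ≤ k ∧ φ h ∈ Dset (p i)) →
      p k * φ (g * h) * p k = p k * φ g * (p k * φ h) := by
    rintro k hk1 hkn g h ⟨i, hi1, hik, hi⟩
    obtain ⟨h1, h2⟩ := hsa k hk1 hkn
    exact hφ.compression_mul hinv h1 h2 (by rw [hone, (hle 1 k le_rfl hk1 hkn).1])
      (hcomm_le i k hi1 hik hkn _ hi) (hcut i k hi1 hik hkn _ hi) g
  have hclosed : ∀ k, 1 ≤ k → k ≤ n → ∀ g h, (∃ i, 1 ≤ i ∧ i ≤ k ∧ φ g ∈ Dset (p i)) →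
      (∃ i, 1 ≤ i ∧ i ≤ k ∧ φ h ∈ Dset (p i)) →
      ∃ i, 1 ≤ i ∧ i ≤ k ∧ φ (g * h) ∈ Dset (p i) := by
    rintro k hk1 hkn g h ⟨i, hi1, hik, hi⟩ hh
    have hm := hmul k hk1 hkn g h hh
    obtain ⟨j, hj1, hjk, hj⟩ := hh
    obtain ⟨h1, h2⟩ := hsa k hk1 hkn
    have hD := mul_mem_Dset h1 h2 (hcut i k hi1 hik hkn _ hi) (hcut j k hj1 hjk hkn _ hj)
    obtain ⟨l, hl1, hln, hl⟩ := hrange (g * h)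
    obtain hlk | hkl := le_or_gt l k
    · exact ⟨l, hl1, hlk, hl⟩
    · obtain ⟨h3, h4⟩ := hsa l hl1 hln
      obtain ⟨h5, h6⟩ := hle k l hk1 hkl.le hln
      refine ⟨k, hk1, le_rfl, ?_⟩
      have hleft := mul_eq_self_of_mem_Dset' h3 h4 hl
      have hright := mul_eq_self_of_mem_Dset h3 h4 hl
      have hfix : p k * φ (g * h) * p k = φ (g * h) := by
        rw [← hleft, ← mul_assoc, h5, hleft, ← hright, mul_assoc, h6]
      rwa [← hm, hfix] at hD
  have hsub : ∀ k, ∃ K : Subgroup H, 1 ≤ k → k ≤ n →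
      ∀ h, h ∈ K ↔ ∃ i, 1 ≤ i ∧ i ≤ k ∧ φ h ∈ Dset (p i) := by
    intro k
    by_cases hk : 1 ≤ k ∧ k ≤ n
    · obtain ⟨hk1, hkn⟩ := hk
      refine ⟨{ carrier := {h | ∃ i, 1 ≤ i ∧ i ≤ k ∧ φ h ∈ Dset (p i)}
                mul_mem' := fun hg hh => hclosed k hk1 hkn _ _ hg hh
                one_mem' := ⟨1, le_rfl, hk1, ?_⟩
                inv_mem' := ?_ }, fun _ _ h => Iff.rfl⟩
      · obtain ⟨h1, h2⟩ := hsa 1 le_rfl hn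
        rw [hone]
        exact ⟨by rw [h1, h2], by rw [h1, h2]⟩
      · rintro h ⟨i, hi1, hik, hi⟩
        exact ⟨i, hi1, hik, by rw [hinv]; exact star_mem_Dset hi⟩
    · exact ⟨⊤, fun h1 h2 => absurd ⟨h1, h2⟩ hk⟩
  choose K hK using hsub
  refine ⟨hone, K, fun k h => p k * φ h, ?_, ?_, ?_, ?_, ?_, ?_⟩
  · exact (Subgroup.eq_top_iff' _).2 fun h => (hK n hn le_rfl h).2 (hrange h)
  · intro i hi1 hin h hh
    obtain ⟨j, hj1, hji, hj⟩ := (hK i hi1 hin.le h).1 hh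
    exact (hK (i + 1) (by omega) hin h).2 ⟨j, hj1, by omega, hj⟩
  · intro i hi1 hin h hh
    obtain ⟨j, hj1, hji, hj⟩ := (hK i hi1 hin h).1 hh
    exact hcut j i hj1 hji hin _ hj
  · intro i hi1 hin h hh k hk
    obtain ⟨j, hj1, hji, hj⟩ := (hK i hi1 hin _).1 ((K i).mul_mem hh hk)
    rw [← hmul i hi1 hin h k ((hK i hi1 hin k).1 hk), mul_assoc, ← hcomm_le j i hj1 hji hin _ hj,
      ← mul_assoc, (hsa i hi1 hin).2]
  · intro i hi1 hin h _
    simp only [← mul_assoc, (hchain i hi1 hin).2]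
  · intro k hk1 hkn h hh hk
    obtain ⟨j, hj1, hjk, hj⟩ := (hK k hk1 hkn h).1 hh
    obtain rfl : j = k := by
      by_contra hne
      obtain rfl | hk := hk
      · omega
      · exact hk ((hK (k - 1) (by omega) (by omega) h).2 ⟨j, hj1, by omega, hj⟩)
    exact (mul_eq_self_of_mem_Dset' (hsa j hj1 hkn).1 (hsa j hj1 hkn).2 hj).symm
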